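/- Let m ≥ 6 with m ≡ 0 (mod 6) be a fundamental point of c such that m - 1 and m + 1 are both prime, and let m' be the least fundamental point of c with m' > m (assuming one exists). Suppose every index n with m + 3 < n ≤ m' at which c(n) - c(n-1) > 1 satisfies n ≤ m' - √(m' - 1) - 4. Then m' ≡ 0 (mod 6), and consequently m' - 2m ≡ 0 (mod 6) (i.e., the sum T of the minor increments between m and m' satisfies T ≡ h (mod 6), where h is their number). -/

import Mathlib

/-- The sequence `c` from the paper: `c 1 = 2` and, for `n ≥ 2`,
`c n = c (n-1) + gcd (n, c (n-1))` if `n` is even, and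
`c n = c (n-1) + gcd (n-2, c (n-1))` if `n` is odd. -/
def c : ℕ → ℕ
  | 0 => 0
  | 1 => 2
  | n + 2 =>
    c (n + 1) +
      (if (n + 2) % 2 = 0 then Nat.gcd (n + 2) (c (n + 1)) else Nat.gcd n (c (n + 1)))

/-- A fundamental point of `c`: an integer `n ≥ 2` with `c n = 2 n`. -/
def IsFundamentalC (n : ℕ) : Prop := 2 ≤ n ∧ c n = 2 * n

theorem c_succ_of_even {n : ℕ} (hn : 1 ≤ n) (h : (n + 1) % 2 = 0) :
    c (n + 1) = c n + Nat.gcd (n + 1) (c n) := by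
  obtain ⟨k, rfl⟩ := Nat.exists_eq_add_of_le' hn
  rw [c, if_pos h]

theorem c_succ_of_odd {n : ℕ} (hn : 1 ≤ n) (h : (n + 1) % 2 = 1) :
    c (n + 1) = c n + Nat.gcd (n - 1) (c n) := by
  obtain ⟨k, rfl⟩ := Nat.exists_eq_add_of_le' hn
  rw [c, if_neg (by omega), Nat.add_sub_cancel]

theorem c_pos {n : ℕ} (hn : 1 ≤ n) : 0 < c n := by
  induction n, hn using Nat.le_induction with
  | base => decide
  | succ k hk ih =>
    rcases Nat.mod_two_eq_zero_or_one (k + 1) with h | h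
    · rw [c_succ_of_even hk h]; omega
    · rw [c_succ_of_odd hk h]; omega

theorem c_lt_c_succ {n : ℕ} (hn : 1 ≤ n) : c n < c (n + 1) := by
  rcases Nat.mod_two_eq_zero_or_one (n + 1) with h | h
  · rw [c_succ_of_even hn h]
    exact Nat.lt_add_of_pos_right (Nat.gcd_pos_of_pos_right _ (c_pos hn))
  · rw [c_succ_of_odd hn h]
    exact Nat.lt_add_of_pos_right (Nat.gcd_pos_of_pos_right _ (c_pos hn))

theorem c_add_le {n : ℕ} (hn : 1 ≤ n) (k : ℕ) : c n + k ≤ c (n + k) := by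
  induction k with
  | zero => rfl
  | succ k ih =>
    have : c (n + k) < c (n + (k + 1)) := c_lt_c_succ (by omega)
    omega

/-- The values of `c` right after a fundamental point divisible by `6`. -/
theorem c_after_fundamental {m : ℕ} (h6 : 6 ≤ m) (hmod : m % 6 = 0) (hfund : c m = 2 * m) :
    c (m + 1) = 2 * m + 1 ∧ c (m + 2) = 2 * m + 2 ∧ c (m + 3) = 3 * m + 3 := by
  have h1 : c (m + 1) = 2 * m + 1 := by
    rw [c_succ_of_odd (by omega) (by omega), hfund]
    have hd : Nat.gcd (m - 1) (2 * m) ∣ 2 := by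
      have := Nat.dvd_sub (Nat.gcd_dvd_right (m - 1) (2 * m))
        ((Nat.gcd_dvd_left (m - 1) (2 * m)).mul_left 2)
      rwa [show 2 * m - 2 * (m - 1) = 2 by omega] at this
    rcases (Nat.dvd_prime Nat.prime_two).1 hd with h | h
    · rw [h]
    · have := Nat.gcd_dvd_left (m - 1) (2 * m)
      rw [h] at this
      omega
  have h2 : c (m + 2) = 2 * m + 2 := by
    rw [c_succ_of_even (n := m + 1) (by omega) (by omega), h1]
    have hd : Nat.gcd (m + 2) (2 * m + 1) ∣ 3 := by
      have := Nat.dvd_sub ((Nat.gcd_dvd_left (m + 2) (2 * m + 1)).mul_left 2)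
        (Nat.gcd_dvd_right (m + 2) (2 * m + 1))
      rwa [show 2 * (m + 2) - (2 * m + 1) = 3 by omega] at this
    rcases (Nat.dvd_prime Nat.prime_three).1 hd with h | h
    · rw [show m + 1 + 1 = m + 2 by rfl, h]
    · have := Nat.gcd_dvd_left (m + 2) (2 * m + 1)
      rw [h] at this
      omega
  refine ⟨h1, h2, ?_⟩
  rw [c_succ_of_odd (n := m + 2) (by omega) (by omega), h2,
    Nat.gcd_eq_left (show m + 2 - 1 ∣ 2 * m + 2 from ⟨2, by omega⟩)]
  omega

theorem two_mul_le_of_fundamental_of_lt {m k : ℕ} (h6 : 6 ≤ m) (hmod : m % 6 = 0)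
    (hfund : c m = 2 * m) (hk : c k = 2 * k) (hlt : m < k) : 2 * m ≤ k := by
  obtain ⟨h1, h2, h3⟩ := c_after_fundamental h6 hmod hfund
  rcases lt_or_ge k (m + 3) with h | h
  · obtain rfl | rfl : k = m + 1 ∨ k = m + 2 := by omega
    all_goals omega
  · obtain ⟨j, rfl⟩ := Nat.exists_eq_add_of_le h
    have := c_add_le (n := m + 3) (by omega) j
    omega

/-- If the last five increments before a fundamental point all equal `1`, then it is divisible
by `6`. -/
theorem mod_six_eq_zero_of_last_increments {k : ℕ} (hk : 5 ≤ k) (hfund : c k = 2 * k)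
    (hinc : ∀ n, k ≤ n + 4 → n ≤ k → c n = c (n - 1) + 1) : k % 6 = 0 := by
  obtain ⟨j, rfl⟩ := Nat.exists_eq_add_of_le' hk
  have e0 : c (j + 5) = c (j + 4) + 1 := hinc _ (by omega) (by omega)
  have e1 : c (j + 4) = c (j + 3) + 1 := hinc _ (by omega) (by omega)
  have e2 : c (j + 3) = c (j + 2) + 1 := hinc _ (by omega) (by omega)
  have e3 : c (j + 2) = c (j + 1) + 1 := hinc _ (by omega) (by omega)
  have e4 : c (j + 1) = c j + 1 := hinc _ (by omega) (by omega)
  have hj : 1 ≤ j := by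
    by_contra h
    obtain rfl : j = 0 := by omega
    exact absurd hfund (by decide)
  have hodd : j % 2 = 1 := by
    by_contra h
    have e : c (j + 4) = c (j + 3) + Nat.gcd (j + 4) (c (j + 3)) :=
      c_succ_of_even (by omega) (by omega)
    rw [show c (j + 3) = 2 * (j + 4) by omega, Nat.gcd_eq_left (Dvd.intro_left 2 rfl)] at e
    omega
  have g1 : Nat.gcd (j + 1) (c j) = 1 := by
    have := c_succ_of_even hj (by omega)
    omega
  have g2 : Nat.gcd j (c (j + 1)) = 1 := by
    have := c_succ_of_odd (n := j + 1) (by omega) (by omega)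
    rw [Nat.add_sub_cancel] at this
    have e : c (j + 1 + 1) = c (j + 1) + 1 := e3
    omega
  have t1 : ¬ 3 ∣ j + 1 := fun h => by
    have := Nat.dvd_gcd h (show 3 ∣ c j by omega)
    omega
  have t2 : ¬ 3 ∣ j := fun h => by
    have := Nat.dvd_gcd h (show 3 ∣ c (j + 1) by omega)
    omega
  have h3 : j % 3 = 1 := by omega
  omega

/-- If `m ≥ 6`, `m ≡ 0 (mod 6)`, is a fundamental point of `c` with `m ∓ 1` twin primes,
`m'` is the least fundamental point of `c` greater than `m`, and every minor increment
strictly between `m + 3` and `m'` occurs at an index `n ≤ m' - √(m' - 1) - 4`, then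
`m' ≡ 0 (mod 6)` and consequently `m' - 2 m ≡ 0 (mod 6)` (i.e. the sum `T` of the minor
increments satisfies `T ≡ h (mod 6)` where `h` is their number). -/
theorem next_fundamental_point_mod_six
    (m m' : ℕ) (h6 : 6 ≤ m) (hmod : m % 6 = 0) (hfund : c m = 2 * m)
    (hp : Nat.Prime (m - 1)) (hp' : Nat.Prime (m + 1))
    (hm' : IsFundamentalC m') (hlt : m < m')
    (hleast : ∀ k : ℕ, IsFundamentalC k → m < k → m' ≤ k)
    (hminor : ∀ n : ℕ, m + 3 < n → n ≤ m' → 1 < c n - c (n - 1) →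
      (n : ℝ) ≤ (m' : ℝ) - Real.sqrt ((m' : ℝ) - 1) - 4) :
    m' % 6 = 0 ∧ ((m' : ℤ) - 2 * (m : ℤ)) % 6 = 0 := by
  have hm6 : m' % 6 = 0 := by
    rcases eq_or_lt_of_le h6 with rfl | hm
    · have h12 : c 12 = 24 := by decide
      have := hleast 12 ⟨by omega, h12⟩ (by omega)
      have := two_mul_le_of_fundamental_of_lt h6 hmod hfund hm'.2 hlt
      omega
    · have hle := two_mul_le_of_fundamental_of_lt h6 hmod hfund hm'.2 hlt
      refine mod_six_eq_zero_of_last_increments (by omega) hm'.2 fun n hn hn' => ?_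
      have hlt' : c (n - 1) < c (n - 1 + 1) := c_lt_c_succ (by omega)
      rw [Nat.sub_add_cancel (by omega)] at hlt'
      by_contra hne
      have hbound := hminor n (by omega) hn' (by omega)
      have hsqrt : 0 < Real.sqrt ((m' : ℝ) - 1) := by
        have : (2 : ℝ) ≤ m' := by exact_mod_cast hm'.1
        exact Real.sqrt_pos.2 (by linarith)
      have : (m' : ℝ) ≤ n + 4 := by exact_mod_cast hn
      linarith
  exact ⟨hm6, by omega⟩
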